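/- arXiv:1603.08937 — 3 statements merged into one kernel-verified Lean document; each statement's English description precedes it below -/
import Mathlib

section
/- Let p : U → Y be a continuous map of topological spaces. Suppose that for every n ∈ ℕ there exists an open cover {Y_α}_{α∈A} of Y (which may depend on n) such that for every α ∈ A and every k ≤ n the restriction p : p⁻¹(Y_α) → Y_α has the relative homotopy lifting property for the cube pair ([0,1]^k, ∂[0,1]^k). Then p is a Serre fibration, i.e. for every n ∈ ℕ, every continuous H : [0,1]^n × [0,1] → Y and every continuous h₀ : [0,1]^n → U with p ∘ h₀ = H(·,0), there exists a continuous H̃ : [0,1]^n × [0,1] → U with p ∘ H̃ = H and H̃(·,0) = h₀. -/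
/-- The boundary of the cube `[0,1]^k` (viewed inside `ℝ^k`): the points where
some coordinate equals `0` or `1`. -/
def cubeBoundary (k : ℕ) : Set (Fin k → unitInterval) :=
  {x | ∃ i, x i = 0 ∨ x i = 1}

/-- A map `q : E → B` has the relative homotopy lifting property for the cube
pair `([0,1]^k, ∂[0,1]^k)`: any homotopy `H` into `B`, with a time-zero lift `h₀`
and a lift `G` prescribed on the boundary (compatible with `h₀`), admits a lift
extending both. -/
def HasRelCubeHLP {E B : Type*} [TopologicalSpace E] [TopologicalSpace B]
    (q : E → B) (k : ℕ) : Prop :=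
  ∀ (H : (Fin k → unitInterval) × unitInterval → B)
    (h₀ : (Fin k → unitInterval) → E)
    (G : (cubeBoundary k) × unitInterval → E),
    Continuous H → Continuous h₀ → Continuous G →
    (∀ x, q (h₀ x) = H (x, 0)) →
    (∀ (x : cubeBoundary k) (t : unitInterval), q (G (x, t)) = H ((x : Fin k → unitInterval), t)) →
    (∀ x : cubeBoundary k, G (x, 0) = h₀ (x : Fin k → unitInterval)) →
    ∃ H' : (Fin k → unitInterval) × unitInterval → E,
      Continuous H' ∧ (∀ p, q (H' p) = H p) ∧ (∀ x, H' (x, 0) = h₀ x) ∧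
      (∀ (x : cubeBoundary k) (t : unitInterval), H' ((x : Fin k → unitInterval), t) = G (x, t))

namespace SerreLocal

open Set Function

/-- The part `I^n × {0} ∪ ∂I^n × I` of the boundary of `I × I^n`, where the coordinate of index `0`
is regarded as time. -/
def openBox (n : ℕ) : Set (Fin (n + 1) → unitInterval) :=
  {x | x 0 = 0 ∨ ∃ i : Fin n, x i.succ = 0 ∨ x i.succ = 1}

/-- Every partial lift of `H` through `p` defined on `openBox n` extends to a full lift. -/
def LiftsFromBox {U Y : Type*} [TopologicalSpace U] (p : U → Y) {n : ℕ}
    (H : (Fin (n + 1) → unitInterval) → Y) : Prop :=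
  ∀ F : (Fin (n + 1) → unitInterval) → U, ContinuousOn F (openBox n) →
    (∀ x ∈ openBox n, p (F x) = H x) →
    ∃ F' : (Fin (n + 1) → unitInterval) → U,
      Continuous F' ∧ (∀ x, p (F' x) = H x) ∧ EqOn F' F (openBox n)

/-- The midpoint of the unit interval. -/
noncomputable def mid : unitInterval := ⟨1 / 2, by norm_num, by norm_num⟩

/-- The affine map of the unit interval onto `[0, 1/2]`. -/
noncomputable def lowerHalf : C(unitInterval, unitInterval) where
  toFun t := ⟨(t : ℝ) / 2, by have := t.2.1; linarith, by have := t.2.2; linarith⟩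
  continuous_toFun := by fun_prop

/-- The affine map of the unit interval onto `[1/2, 1]`. -/
noncomputable def upperHalf : C(unitInterval, unitInterval) where
  toFun t := ⟨(1 + t : ℝ) / 2, by have := t.2.1; linarith, by have := t.2.2; linarith⟩
  continuous_toFun := by fun_prop

/-- A continuous retraction onto the lower half followed by rescaling. -/
noncomputable def lowerInv (t : unitInterval) : unitInterval :=
  projIcc 0 1 zero_le_one (2 * t : ℝ)

/-- A continuous retraction onto the upper half followed by rescaling. -/
noncomputable def upperInv (t : unitInterval) : unitInterval :=
  projIcc 0 1 zero_le_one (2 * t - 1 : ℝ)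

lemma continuous_lowerInv : Continuous lowerInv :=
  continuous_projIcc.comp (by fun_prop)

lemma continuous_upperInv : Continuous upperInv :=
  continuous_projIcc.comp (by fun_prop)

lemma lowerHalf_lowerInv {t : unitInterval} (ht : t ≤ mid) : lowerHalf (lowerInv t) = t := by
  have h : (t : ℝ) ≤ 1 / 2 := ht
  have h0 := t.2.1
  ext
  simp only [lowerHalf, lowerInv, ContinuousMap.coe_mk]
  rw [projIcc_of_mem zero_le_one (x := (2 * t : ℝ)) ⟨by linarith, by linarith⟩]
  simp

lemma upperHalf_upperInv {t : unitInterval} (ht : mid ≤ t) : upperHalf (upperInv t) = t := by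
  have h : 1 / 2 ≤ (t : ℝ) := ht
  have h1 := t.2.2
  ext
  simp only [upperHalf, upperInv, ContinuousMap.coe_mk]
  rw [projIcc_of_mem zero_le_one (x := (2 * t - 1 : ℝ)) ⟨by linarith, by linarith⟩]
  simp

lemma lowerHalf_zero : lowerHalf 0 = 0 := by ext; simp [lowerHalf]

lemma lowerHalf_one : lowerHalf 1 = mid := by ext; simp [lowerHalf, mid]

lemma upperHalf_zero : upperHalf 0 = mid := by ext; simp [upperHalf, mid]

lemma upperHalf_one : upperHalf 1 = 1 := by ext; simp [upperHalf]

lemma lowerInv_mid : lowerInv mid = 1 := by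
  simp [lowerInv, mid, projIcc_right]

lemma upperInv_mid : upperInv mid = 0 := by
  simp [upperInv, mid, projIcc_left]

lemma isClosed_openBox (n : ℕ) : IsClosed (openBox n) := by
  have : openBox n = {x | x 0 = 0} ∪ ⋃ i : Fin n, ({x | x i.succ = 0} ∪ {x | x i.succ = 1}) := by
    ext x; simp [openBox]
  rw [this]
  refine (isClosed_eq (by fun_prop) (by fun_prop)).union (isClosed_iUnion_of_finite fun i => ?_)
  exact (isClosed_eq (by fun_prop) (by fun_prop)).union (isClosed_eq (by fun_prop) (by fun_prop))

lemma update_lowerHalf_mem {n : ℕ} (j : Fin (n + 1)) {x : Fin (n + 1) → unitInterval}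
    (hx : x ∈ openBox n) :
    update x j (lowerHalf (x j)) ∈ openBox n ∪ {y | y j = mid} := by
  have key : ∀ i : Fin (n + 1), i ≠ j → update x j (lowerHalf (x j)) i = x i :=
    fun i hi => update_of_ne hi _ _
  rcases hx with h | ⟨i, h⟩
  · left; left
    by_cases hj : (0 : Fin (n + 1)) = j
    · subst hj; simp [h, lowerHalf_zero]
    · rw [key _ hj, h]
  · by_cases hj : i.succ = j
    · subst hj
      rcases h with h | h
      · left; right; exact ⟨i, Or.inl (by simp [h, lowerHalf_zero])⟩
      · right; simp [h, lowerHalf_one]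
    · left; right; exact ⟨i, by rwa [key _ hj]⟩

lemma update_upperHalf_mem {n : ℕ} (j : Fin (n + 1)) {x : Fin (n + 1) → unitInterval}
    (hx : x ∈ openBox n) :
    update x j (upperHalf (x j)) ∈ openBox n ∪ {y | y j = mid} := by
  have key : ∀ i : Fin (n + 1), i ≠ j → update x j (upperHalf (x j)) i = x i :=
    fun i hi => update_of_ne hi _ _
  rcases hx with h | ⟨i, h⟩
  · by_cases hj : (0 : Fin (n + 1)) = j
    · right; subst hj; simp [h, upperHalf_zero]
    · left; left; rw [key _ hj, h]
  · by_cases hj : i.succ = j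
    · subst hj
      rcases h with h | h
      · right; simp [h, upperHalf_zero]
      · left; right; exact ⟨i, Or.inr (by simp [h, upperHalf_one])⟩
    · left; right; exact ⟨i, by rwa [key _ hj]⟩

lemma mem_openBox_of_eq_zero {n : ℕ} (j : Fin (n + 1)) {x : Fin (n + 1) → unitInterval}
    (hx : x j = 0) : x ∈ openBox n := by
  cases j using Fin.cases with
  | zero => exact Or.inl hx
  | succ i => exact Or.inr ⟨i, Or.inl hx⟩

lemma mem_openBox_of_eq_one {n : ℕ} {j : Fin (n + 1)} (hj : j ≠ 0)
    {x : Fin (n + 1) → unitInterval} (hx : x j = 1) : x ∈ openBox n := by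
  obtain ⟨i, rfl⟩ := Fin.exists_succ_eq.2 hj
  exact Or.inr ⟨i, Or.inr hx⟩

lemma mid_pos : 0 < mid := by
  change (0 : ℝ) < 1 / 2
  norm_num

lemma mid_lt_one : mid < 1 := by
  change (1 / 2 : ℝ) < 1
  norm_num

/-- Replacing a coordinate inside the open box keeps the point in the open box if the replacement
fixes the endpoints that matter. -/
lemma update_mem_openBox {n : ℕ} {j : Fin (n + 1)} {x : Fin (n + 1) → unitInterval}
    {t : unitInterval} (hx : x ∈ openBox n) (h0 : x j = 0 → t = 0)
    (h1 : j ≠ 0 → x j = 1 → t = 1) : update x j t ∈ openBox n := by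
  by_cases hj0 : x j = 0
  · exact mem_openBox_of_eq_zero j (by simp [h0 hj0])
  by_cases hj1 : j ≠ 0 ∧ x j = 1
  · exact mem_openBox_of_eq_one hj1.1 (by simp [h1 hj1.1 hj1.2])
  rcases hx with h | ⟨i, h⟩
  · have hj : (0 : Fin (n + 1)) ≠ j := by rintro rfl; exact hj0 h
    exact Or.inl (by rwa [update_of_ne hj])
  · have hj : i.succ ≠ j := by
      rintro rfl
      rcases h with h | h
      exacts [hj0 h, hj1 ⟨Fin.succ_ne_zero i, h⟩]
    exact Or.inr ⟨i, by rwa [update_of_ne hj]⟩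

section Lifting

variable {U Y : Type*} [TopologicalSpace U] {p : U → Y} {n : ℕ}

/-- A partial lift on the open box and a compatible lift `M` on the slice `x j = 1/2` combine into
a partial lift on the union. -/
lemma exists_extension_to_slice {H : (Fin (n + 1) → unitInterval) → Y} (j : Fin (n + 1))
    {F M : (Fin (n + 1) → unitInterval) → U}
    (hF : ContinuousOn F (openBox n)) (hFH : ∀ x ∈ openBox n, p (F x) = H x)
    (hM : Continuous M) (hMH : ∀ x, x j = mid → p (M x) = H x)
    (hMF : ∀ x ∈ openBox n, x j = mid → M x = F x) :
    ∃ E : (Fin (n + 1) → unitInterval) → U, ContinuousOn E (openBox n ∪ {y | y j = mid}) ∧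
      (∀ x ∈ openBox n ∪ {y | y j = mid}, p (E x) = H x) ∧ EqOn E F (openBox n) ∧
      EqOn E M {y | y j = mid} := by
  classical
  let S : Set (Fin (n + 1) → unitInterval) := {y | y j = mid}
  have hS : IsClosed S := isClosed_eq (by fun_prop) (by fun_prop)
  let E : (Fin (n + 1) → unitInterval) → U := S.piecewise M F
  have hES : EqOn E M S := fun x hx => piecewise_eq_of_mem _ _ _ hx
  have hEJ : EqOn E F (openBox n) := fun x hx => by
    by_cases h : x ∈ S
    · rw [hES h, hMF x hx h]
    · exact piecewise_eq_of_notMem _ _ _ h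
  refine ⟨E, (hF.congr hEJ).union_of_isClosed (hM.continuousOn.congr hES) (isClosed_openBox n) hS,
    ?_, hEJ, hES⟩
  rintro x (hx | hx)
  · rw [hEJ hx, hFH x hx]
  · rw [hES hx, hMH x hx]

/-- A partial lift `E` on the open box and the slice `x j = 1/2`, together with a compatible lift
over the lower half, extends if lifting is possible over the upper half. -/
lemma exists_lift_of_lower_half {H : (Fin (n + 1) → unitInterval) → Y} (j : Fin (n + 1))
    {E F₁ : (Fin (n + 1) → unitInterval) → U}
    (hE : ContinuousOn E (openBox n ∪ {y | y j = mid}))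
    (hEH : ∀ x ∈ openBox n ∪ {y | y j = mid}, p (E x) = H x)
    (hF₁ : Continuous F₁) (hF₁H : ∀ x, p (F₁ x) = H (update x j (lowerHalf (x j))))
    (hF₁E : ∀ x ∈ openBox n, F₁ x = E (update x j (lowerHalf (x j))))
    (hF₁M : ∀ x, x j = 1 → F₁ x = E (update x j mid))
    (hup : LiftsFromBox p fun x => H (update x j (upperHalf (x j)))) :
    ∃ F' : (Fin (n + 1) → unitInterval) → U,
      Continuous F' ∧ (∀ x, p (F' x) = H x) ∧ EqOn F' E (openBox n) := by
  classical
  obtain ⟨F₂, hF₂, hF₂H, hF₂E⟩ := hup (fun x => E (update x j (upperHalf (x j))))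
    (hE.comp (by fun_prop) fun x hx => update_upperHalf_mem j hx)
    (fun x hx => hEH _ (update_upperHalf_mem j hx))
  refine ⟨fun x => if x j ≤ mid then F₁ (update x j (lowerInv (x j)))
    else F₂ (update x j (upperInv (x j))), ?_, fun x => ?_, fun x hx => ?_⟩
  · have h₁ := continuous_lowerInv
    have h₂ := continuous_upperInv
    refine Continuous.if_le (by fun_prop) (by fun_prop) (by fun_prop) (by fun_prop) fun x hx => ?_
    rw [hx, lowerInv_mid, upperInv_mid, hF₁M _ (by simp),
      hF₂E (mem_openBox_of_eq_zero j (by simp))]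
    simp [upperHalf_zero]
  · dsimp only
    split_ifs with h
    · simp [hF₁H, lowerHalf_lowerInv h]
    · simp [hF₂H, upperHalf_upperInv (le_of_not_ge h)]
  · dsimp only
    split_ifs with h
    · rw [hF₁E]
      · simp [lowerHalf_lowerInv h]
      · refine update_mem_openBox hx (fun h => by simp [h, lowerInv, projIcc_left]) fun _ h1 => ?_
        exact absurd h (not_le.2 (h1 ▸ mid_lt_one))
    · rw [hF₂E]
      · simp [upperHalf_upperInv (le_of_not_ge h)]
      · refine update_mem_openBox hx (fun h0 => ?_) fun _ h1 => ?_
        · exact absurd (h0 ▸ mid_pos.le) h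
        · rw [h1, upperInv]
          norm_num [projIcc_right]

/-- Lifting over the two halves in the time direction gives lifting. -/
lemma LiftsFromBox.of_halves_zero {H : (Fin (n + 1) → unitInterval) → Y}
    (hlow : LiftsFromBox p fun x => H (update x 0 (lowerHalf (x 0))))
    (hup : LiftsFromBox p fun x => H (update x 0 (upperHalf (x 0)))) : LiftsFromBox p H := by
  intro F hF hFH
  have hmaps : ∀ x ∈ openBox n, update x 0 (lowerHalf (x 0)) ∈ openBox n := fun x hx =>
    update_mem_openBox hx (fun h => by rw [h, lowerHalf_zero]) fun h => absurd rfl h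
  obtain ⟨F₁, hF₁, hF₁H, hF₁F⟩ := hlow (fun x => F (update x 0 (lowerHalf (x 0))))
    (hF.comp (by fun_prop) hmaps) (fun x hx => hFH _ (hmaps x hx))
  obtain ⟨E, hE, hEH, hEF, hEM⟩ := exists_extension_to_slice (p := p) (H := H) 0
    (M := fun x => F₁ (update x 0 1)) hF hFH (by fun_prop)
    (fun x hx => by rw [hF₁H]; simp [lowerHalf_one, ← hx])
    (fun x hx h => by
      rw [hF₁F (update_mem_openBox hx (fun h0 => absurd (h.symm.trans h0) mid_pos.ne')
        fun h => absurd rfl h)]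
      simp [lowerHalf_one, ← h])
  obtain ⟨F', hF', hF'H, hF'E⟩ := exists_lift_of_lower_half 0 hE hEH hF₁ hF₁H
    (fun x hx => by rw [hF₁F hx, hEF (hmaps x hx)])
    (fun x hx => by rw [hEM (by simp)]; simp [← hx]) hup
  exact ⟨F', hF', hF'H, hF'E.trans hEF⟩

/-- Lifting over the two halves in a space direction, and over the cube of one dimension less
separating them, gives lifting. -/
lemma LiftsFromBox.of_halves_succ {H : (Fin (n + 2) → unitInterval) → Y} (i : Fin (n + 1))
    (hslice : LiftsFromBox p fun y : Fin (n + 1) → unitInterval => H (i.succ.insertNth mid y))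
    (hlow : LiftsFromBox p fun x => H (update x i.succ (lowerHalf (x i.succ))))
    (hup : LiftsFromBox p fun x => H (update x i.succ (upperHalf (x i.succ)))) :
    LiftsFromBox p H := by
  intro F hF hFH
  have hmaps : ∀ y ∈ openBox n,
      (i.succ.insertNth mid y : Fin (n + 2) → unitInterval) ∈ openBox (n + 1) := by
    rintro y (h | ⟨k, h⟩)
    · left
      rw [← h, ← Fin.succ_succAbove_zero i, Fin.insertNth_apply_succAbove]
    · right
      refine ⟨i.succAbove k, ?_⟩
      rwa [← Fin.succ_succAbove_succ, Fin.insertNth_apply_succAbove]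
  have hremove : ∀ x : Fin (n + 2) → unitInterval, x i.succ = mid → x ∈ openBox (n + 1) →
      i.succ.removeNth x ∈ openBox n := by
    rintro x hx (h | ⟨k, h⟩)
    · left
      rwa [Fin.removeNth, Fin.succ_succAbove_zero]
    · right
      have hk : k ≠ i := by
        rintro rfl
        rcases h with h | h
        exacts [mid_pos.ne' (hx.symm.trans h), mid_lt_one.ne (hx.symm.trans h)]
      obtain ⟨l, rfl⟩ := Fin.exists_succAbove_eq hk
      exact ⟨l, by rwa [Fin.removeNth, Fin.succ_succAbove_succ]⟩
  have hinsert : ∀ x : Fin (n + 2) → unitInterval, x i.succ = mid →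
      i.succ.insertNth mid (i.succ.removeNth x) = x := fun x hx => by
    rw [← hx, Fin.insertNth_self_removeNth]
  obtain ⟨M, hM, hMH, hMF⟩ := hslice (fun y => F (i.succ.insertNth mid y))
    (hF.comp (Continuous.continuousOn (by fun_prop)) hmaps) (fun y hy => hFH _ (hmaps y hy))
  obtain ⟨E, hE, hEH, hEF, hEM⟩ := exists_extension_to_slice (p := p) (H := H) i.succ
    (M := fun x => M (i.succ.removeNth x)) hF hFH
    (hM.comp (continuous_pi fun k => continuous_apply (i.succ.succAbove k)))
    (fun x hx => by rw [hMH]; dsimp only; rw [hinsert x hx])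
    (fun x hx h => by rw [hMF (hremove x h hx)]; dsimp only; rw [hinsert x h])
  obtain ⟨F₁, hF₁, hF₁H, hF₁E⟩ := hlow (fun x => E (update x i.succ (lowerHalf (x i.succ))))
    (hE.comp (by fun_prop) fun x hx => update_lowerHalf_mem _ hx)
    (fun x hx => hEH _ (update_lowerHalf_mem _ hx))
  obtain ⟨F', hF', hF'H, hF'E⟩ := exists_lift_of_lower_half i.succ hE hEH hF₁ hF₁H hF₁E
    (fun x hx => by
      rw [hF₁E (mem_openBox_of_eq_one (Fin.succ_ne_zero i) hx)]
      dsimp only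
      rw [hx, lowerHalf_one]) hup
  exact ⟨F', hF', hF'H, hF'E.trans hEF⟩

end Lifting

/-- Subdivision principle: a property of rescalings `σ` of a cube which holds for all sufficiently
contracting ones, and which holds for `σ` as soon as it holds after halving any one coordinate,
holds for the identity. -/
lemma subdivision_induction {ι : Type*} [Fintype ι] [DecidableEq ι]
    {P : (ι → C(unitInterval, unitInterval)) → Prop} (m : ℕ)
    (hsmall : ∀ σ, (∀ i s t, dist (σ i s) (σ i t) ≤ (1 / 2) ^ m * dist s t) → P σ)
    (hhalf : ∀ σ i, P (update σ i ((σ i).comp lowerHalf)) →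
      P (update σ i ((σ i).comp upperHalf)) → P σ) :
    P fun _ => ContinuousMap.id unitInterval := by
  suffices h : ∀ (k : ℕ) (e : ι → ℕ) (σ : ι → C(unitInterval, unitInterval)),
      ∑ i, (m - e i) = k →
      (∀ i s t, dist (σ i s) (σ i t) ≤ (1 / 2) ^ e i * dist s t) → P σ from
    h _ (fun _ => 0) _ rfl (by simp)
  intro k
  induction k using Nat.strong_induction_on with
  | _ k ih =>
    intro e σ hk hσ
    by_cases hm : ∀ i, m ≤ e i
    · refine hsmall σ fun i s t => (hσ i s t).trans ?_
      gcongr ?_ * _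
      exact pow_le_pow_of_le_one (by norm_num) (by norm_num) (hm i)
    · push Not at hm
      obtain ⟨j, hj⟩ := hm
      have hlt : ∑ i, (m - update e j (e j + 1) i) < k := by
        rw [← hk]
        refine Finset.sum_lt_sum (fun i _ => ?_) ⟨j, Finset.mem_univ j, ?_⟩
        · by_cases h : i = j
          · subst h; simp; omega
          · simp [h]
        · simp; omega
      have hstep : ∀ f : C(unitInterval, unitInterval),
          (∀ s t, dist (f s) (f t) = 1 / 2 * dist s t) → P (update σ j ((σ j).comp f)) := by
        intro f hf
        refine ih _ hlt (update e j (e j + 1)) _ rfl fun i s t => ?_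
        by_cases h : i = j
        · subst h
          simpa [hf, pow_succ, mul_assoc] using hσ i (f s) (f t)
        · simpa [h] using hσ i s t
      refine hhalf σ j (hstep _ fun s t => ?_) (hstep _ fun s t => ?_)
      · simp only [lowerHalf, ContinuousMap.coe_mk, Subtype.dist_eq, Real.dist_eq]
        rw [← sub_div, abs_div]
        norm_num
        ring
      · simp only [upperHalf, ContinuousMap.coe_mk, Subtype.dist_eq, Real.dist_eq]
        rw [← sub_div, abs_div]
        norm_num
        ring

section Global

variable {U Y : Type*} [TopologicalSpace U] [TopologicalSpace Y] {p : U → Y}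

/-- A cube whose image lies in a set over which `p` has the relative lifting property can be
lifted. -/
lemma liftsFromBox_of_range_subset {n : ℕ} {V : Set Y}
    (hV : HasRelCubeHLP (fun e : (p ⁻¹' V : Set U) => (⟨p e.1, e.2⟩ : V)) n)
    {H : (Fin (n + 1) → unitInterval) → Y} (hH : Continuous H) (hHV : ∀ x, H x ∈ V) :
    LiftsFromBox p H := by
  intro F hF hFH
  have hmem : ∀ x ∈ openBox n, F x ∈ p ⁻¹' V := fun x hx => by
    rw [mem_preimage, hFH x hx]; exact hHV x
  have hzero : ∀ x : Fin n → unitInterval,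
      (Fin.cons 0 x : Fin (n + 1) → unitInterval) ∈ openBox n := fun x => Or.inl rfl
  have hbdry : ∀ (x : cubeBoundary n) (t : unitInterval),
      (Fin.cons t x.1 : Fin (n + 1) → unitInterval) ∈ openBox n := fun x t => Or.inr x.2
  obtain ⟨L, hL, hLH, hL0, hLG⟩ := hV (fun q => ⟨H (Fin.cons q.2 q.1), hHV _⟩)
    (fun x => ⟨F (Fin.cons 0 x), hmem _ (hzero x)⟩)
    (fun q => ⟨F (Fin.cons q.2 q.1.1), hmem _ (hbdry q.1 q.2)⟩)
    (by fun_prop)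
    ((hF.comp_continuous (by fun_prop) hzero).subtype_mk _)
    ((hF.comp_continuous (by fun_prop) fun q : cubeBoundary n × unitInterval =>
      hbdry q.1 q.2).subtype_mk _)
    (fun x => Subtype.ext (hFH _ (hzero x)))
    (fun x t => Subtype.ext (hFH _ (hbdry x t)))
    (fun x => rfl)
  refine ⟨fun x => (L (Fin.tail x, x 0)).1, ?_, fun x => ?_, fun x hx => ?_⟩
  · have : Continuous fun x : Fin (n + 1) → unitInterval => Fin.tail x :=
      continuous_pi fun i => continuous_apply i.succ
    fun_prop
  · have := congrArg Subtype.val (hLH (Fin.tail x, x 0))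
    simpa using this
  · rcases hx with h | h
    · dsimp only
      rw [h, hL0]
      dsimp only
      rw [← h, Fin.cons_self_tail]
    · have := congrArg Subtype.val (hLG ⟨Fin.tail x, h⟩ (x 0))
      simpa using this

/-- If lifting can be tested on halves in every direction, then it is local on the base. -/
lemma liftsFromBox_of_halves {n : ℕ} {𝒰 : Set (Set Y)} (hopen : ∀ V ∈ 𝒰, IsOpen V)
    (hcover : ⋃₀ 𝒰 = univ)
    (hloc : ∀ V ∈ 𝒰, HasRelCubeHLP (fun e : (p ⁻¹' V : Set U) => (⟨p e.1, e.2⟩ : V)) n)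
    (hhalf : ∀ (H : (Fin (n + 1) → unitInterval) → Y) (j : Fin (n + 1)), Continuous H →
      LiftsFromBox p (fun x => H (update x j (lowerHalf (x j)))) →
      LiftsFromBox p (fun x => H (update x j (upperHalf (x j)))) → LiftsFromBox p H)
    {H : (Fin (n + 1) → unitInterval) → Y} (hH : Continuous H) : LiftsFromBox p H := by
  obtain ⟨δ, hδ, hball⟩ := lebesgue_number_lemma_of_metric_sUnion
    (s := (univ : Set (Fin (n + 1) → unitInterval))) (c := preimage H '' 𝒰) isCompact_univ
    (by rintro _ ⟨V, hV, rfl⟩; exact (hopen V hV).preimage hH)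
    (by rw [sUnion_image, ← preimage_iUnion₂, ← sUnion_eq_biUnion, hcover, preimage_univ])
  obtain ⟨m, hm⟩ := exists_pow_lt_of_lt_one hδ (by norm_num : (1 / 2 : ℝ) < 1)
  refine subdivision_induction
    (P := fun σ : Fin (n + 1) → C(unitInterval, unitInterval) =>
      LiftsFromBox p fun x => H fun i => σ i (x i)) m (fun σ hσ => ?_) (fun σ j hlow hup => ?_)
  · obtain ⟨_, ⟨V, hV, rfl⟩, hsub⟩ := hball (fun i => σ i 0) (mem_univ _)
    refine liftsFromBox_of_range_subset (hloc V hV) (by fun_prop) fun x => hsub ?_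
    refine Metric.mem_ball.2 (lt_of_le_of_lt ((dist_pi_le_iff (by positivity)).2 fun i => ?_) hm)
    refine (hσ i _ _).trans (mul_le_of_le_one_right (by positivity) ?_)
    rw [Subtype.dist_eq]
    exact Real.dist_le_of_mem_Icc_01 (x i).2 (0 : unitInterval).2
  · have key : ∀ (f : C(unitInterval, unitInterval)) (x : Fin (n + 1) → unitInterval),
        (fun i => σ i (update x j (f (x j)) i)) =
          fun i => update σ j ((σ j).comp f) i (x i) := by
      intro f x
      funext i
      by_cases h : i = j
      · subst h; simp
      · simp [h]
    refine hhalf _ j (by fun_prop) ?_ ?_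
    · simpa only [key] using hlow
    · simpa only [key] using hup

/-- The relative lifting property for cubes is local on the base. -/
lemma liftsFromBox_of_local
    (hloc : ∀ n : ℕ, ∃ 𝒰 : Set (Set Y), (∀ V ∈ 𝒰, IsOpen V) ∧ ⋃₀ 𝒰 = univ ∧
      ∀ V ∈ 𝒰, HasRelCubeHLP (fun e : (p ⁻¹' V : Set U) => (⟨p e.1, e.2⟩ : V)) n)
    (n : ℕ) : ∀ H : (Fin (n + 1) → unitInterval) → Y, Continuous H → LiftsFromBox p H := by
  induction n with
  | zero =>
    intro H hH
    obtain ⟨𝒰, hopen, hcover, hV⟩ := hloc 0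
    refine liftsFromBox_of_halves hopen hcover hV (fun H j _ hlow hup => ?_) hH
    obtain rfl : j = 0 := Fin.fin_one_eq_zero j
    exact .of_halves_zero hlow hup
  | succ n ih =>
    intro H hH
    obtain ⟨𝒰, hopen, hcover, hV⟩ := hloc (n + 1)
    refine liftsFromBox_of_halves hopen hcover hV (fun H j hH hlow hup => ?_) hH
    cases j using Fin.cases with
    | zero => exact .of_halves_zero hlow hup
    | succ i => exact .of_halves_succ i (ih _ (by fun_prop)) hlow hup

/-- Relative lifting for a cube implies absolute lifting: embed the cube as the middle third of a
larger one, on whose boundary the extended homotopy is stationary. -/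
lemma exists_lift_of_liftsFromBox {n : ℕ}
    (hp : ∀ H : (Fin (n + 1) → unitInterval) → Y, Continuous H → LiftsFromBox p H)
    {H : (Fin n → unitInterval) × unitInterval → Y} (hH : Continuous H)
    {h₀ : (Fin n → unitInterval) → U} (hh₀ : Continuous h₀) (hpH : ∀ x, p (h₀ x) = H (x, 0)) :
    ∃ H' : (Fin n → unitInterval) × unitInterval → U,
      Continuous H' ∧ (∀ q, p (H' q) = H q) ∧ (∀ x, H' (x, 0) = h₀ x) := by
  let c : (Fin (n + 1) → unitInterval) → Fin n → unitInterval :=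
    fun x i => projIcc 0 1 zero_le_one (3 * x i.succ - 1 : ℝ)
  let d : (Fin (n + 1) → unitInterval) → ℝ :=
    fun x => dist (fun i : Fin n => (3 * x i.succ - 1 : ℝ)) (fun i => (c x i : ℝ))
  let τ : (Fin (n + 1) → unitInterval) → unitInterval :=
    fun x => projIcc 0 1 zero_le_one (x 0 - d x : ℝ)
  have hc : Continuous c := continuous_pi fun i => continuous_projIcc.comp (by fun_prop)
  have hd : Continuous d := Continuous.dist (by fun_prop) (by fun_prop)
  have hτ : Continuous τ := continuous_projIcc.comp (by fun_prop)
  have hτ_box : ∀ x ∈ openBox n, τ x = 0 := by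
    intro x hx
    refine projIcc_of_le_left _ ?_
    rcases hx with h | ⟨i, h⟩
    · have : 0 ≤ d x := dist_nonneg
      rw [h]
      simpa using this
    · have hi : dist (3 * x i.succ - 1 : ℝ) (c x i : ℝ) ≤ d x :=
        dist_le_pi_dist (fun i : Fin n => (3 * x i.succ - 1 : ℝ)) (fun i => (c x i : ℝ)) i
      have h1 : (1 : ℝ) ≤ dist (3 * x i.succ - 1 : ℝ) (c x i : ℝ) := by
        rw [Real.dist_eq]
        have h0 := (c x i).2.1
        have h1 := (c x i).2.2
        rcases h with h | h
        · rw [h, abs_sub_comm, le_abs]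
          left
          push_cast
          linarith
        · rw [h, le_abs]
          left
          push_cast
          linarith
      have := (x 0).2.2
      linarith
  obtain ⟨L, hL, hLH, hLF⟩ := hp (fun x => H (c x, τ x)) (by fun_prop) (fun x => h₀ (c x))
    (by fun_prop) (fun x hx => by dsimp only; rw [hpH, hτ_box x hx])
  let e : (Fin n → unitInterval) × unitInterval → Fin (n + 1) → unitInterval :=
    fun q => Fin.cons q.2 fun i => ⟨(1 + q.1 i : ℝ) / 3, by
      have := (q.1 i).2.1; positivity, by have := (q.1 i).2.2; linarith⟩
  have he : Continuous e := by fun_prop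
  have hce : ∀ q, c (e q) = q.1 := by
    intro q
    funext i
    have : (3 * ((1 + q.1 i : ℝ) / 3) - 1 : ℝ) = q.1 i := by ring
    simp only [c, e, Fin.cons_succ, this]
    exact projIcc_val _ _
  have hτe : ∀ q, τ (e q) = q.2 := by
    intro q
    have hd0 : d (e q) = 0 := by
      simp only [d, hce]
      refine dist_eq_zero.2 (funext fun i => ?_)
      simp only [e, Fin.cons_succ]
      ring
    simp only [τ, hd0, sub_zero]
    exact projIcc_val _ _
  refine ⟨fun q => L (e q), by fun_prop, fun q => ?_, fun x => ?_⟩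
  · rw [hLH]
    dsimp only
    rw [hce, hτe]
  · have hx : e (x, 0) ∈ openBox n := Or.inl rfl
    exact (hLF hx).trans (congrArg h₀ (hce (x, 0)))

end Global

end SerreLocal

/-- **The Serre fibration property can be verified locally**, with open covers
that may depend on the dimension `n`: if for every `n` there is an open cover
`𝒰 = {Y_α}` of `Y` such that each restriction `p : p⁻¹(Y_α) → Y_α` has the
relative homotopy lifting property for all cube pairs `([0,1]^k, ∂[0,1]^k)`,
`k ≤ n`, then `p` is a Serre fibration: every homotopy of cubes in `Y` with a
time-zero lift admits a lift. -/
theorem serre_fibration_of_local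
    {U Y : Type*} [TopologicalSpace U] [TopologicalSpace Y]
    (p : U → Y) (hp : Continuous p)
    (hloc : ∀ n : ℕ, ∃ 𝒰 : Set (Set Y),
      (∀ V ∈ 𝒰, IsOpen V) ∧ ⋃₀ 𝒰 = Set.univ ∧
      ∀ V ∈ 𝒰, ∀ k ≤ n,
        HasRelCubeHLP (fun e : (p ⁻¹' V : Set U) => (⟨p e.1, e.2⟩ : V)) k) :
    ∀ (n : ℕ) (H : (Fin n → unitInterval) × unitInterval → Y), Continuous H →
      ∀ h₀ : (Fin n → unitInterval) → U, Continuous h₀ → (∀ x, p (h₀ x) = H (x, 0)) →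
      ∃ H' : (Fin n → unitInterval) × unitInterval → U,
        Continuous H' ∧ (∀ q, p (H' q) = H q) ∧ (∀ x, H' (x, 0) = h₀ x) := by
  exact fun n H hH h₀ hh₀ hpH => SerreLocal.exists_lift_of_liftsFromBox
    (SerreLocal.liftsFromBox_of_local (fun n => by
      obtain ⟨𝒰, hopen, hcover, hV⟩ := hloc n
      exact ⟨𝒰, hopen, hcover, fun V hVU => hV V hVU n le_rfl⟩) n) hH hh₀ hpH
end

section
/- Let m ≥ 1, let W ⊆ ℝ^m be a convex set, let a > 0, and let ψ = (ψ₁, …, ψ_m) : ℝ^m → ℝ^m be continuously differentiable on an open set containing W. Assume that for every v ∈ ℝ^m with ‖v‖ = 1 there exists an index i ∈ {1, …, m} such that |⟨∇ψᵢ(y), v⟩| > a for all y ∈ W. Then for all y₁, y₂ ∈ W one has Σᵢ₌₁^m |ψᵢ(y₁) − ψᵢ(y₂)| ≥ a ‖y₁ − y₂‖. In particular, ψ is injective on W. -/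
/-- **Uniform directional nondegeneracy implies a quantitative lower bound and
injectivity.** Let `W ⊆ ℝ^m` be convex, `a > 0`, and let `ψ : ℝ^m → ℝ^m` be `C¹` on an
open set `U ⊇ W`. If for every unit vector `v` there is an index `i` (depending on `v`
but not on the point) with `|⟨∇ψᵢ(y), v⟩| > a` for all `y ∈ W`, then
`∑ᵢ |ψᵢ(y₁) − ψᵢ(y₂)| ≥ a ‖y₁ − y₂‖` for all `y₁, y₂ ∈ W`; in particular `ψ` is
injective on `W`. -/
theorem injective_of_uniform_directional_bound
    (m : ℕ) (hm : 1 ≤ m)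
    (W : Set (EuclideanSpace ℝ (Fin m))) (hW : Convex ℝ W)
    (a : ℝ) (ha : 0 < a)
    (ψ : EuclideanSpace ℝ (Fin m) → EuclideanSpace ℝ (Fin m))
    (U : Set (EuclideanSpace ℝ (Fin m))) (hU : IsOpen U) (hWU : W ⊆ U)
    (hψ : ContDiffOn ℝ 1 ψ U)
    (hyp : ∀ v : EuclideanSpace ℝ (Fin m), ‖v‖ = 1 →
      ∃ i : Fin m, ∀ y ∈ W, a < |fderiv ℝ (fun z => ψ z i) y v|) :
    (∀ y₁ ∈ W, ∀ y₂ ∈ W,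
      a * ‖y₁ - y₂‖ ≤ ∑ i : Fin m, |ψ y₁ i - ψ y₂ i|) ∧ Set.InjOn ψ W := by
  have key : ∀ y₁ ∈ W, ∀ y₂ ∈ W,
      a * ‖y₁ - y₂‖ ≤ ∑ i : Fin m, |ψ y₁ i - ψ y₂ i| := by
    intro y₁ h₁ y₂ h₂
    rcases eq_or_ne y₁ y₂ with rfl | hne
    · simp
    have hpos : 0 < ‖y₁ - y₂‖ := norm_pos_iff.mpr (sub_ne_zero.mpr hne)
    obtain ⟨i, hi⟩ := hyp (‖y₁ - y₂‖⁻¹ • (y₁ - y₂)) (by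
      rw [norm_smul, norm_inv, norm_norm, inv_mul_cancel₀ hpos.ne'])
    have hd : ∀ y ∈ W, HasFDerivWithinAt (fun z => ψ z i)
        (fderiv ℝ (fun z => ψ z i) y) W y := by
      intro y hy
      have hdiff : DifferentiableAt ℝ ψ y :=
        (hψ.differentiableOn one_ne_zero).differentiableAt (hU.mem_nhds (hWU hy))
      exact (differentiableAt_euclidean.mp hdiff i).hasFDerivAt.hasFDerivWithinAt
    obtain ⟨z, hz, hzeq⟩ := domain_mvt hd hW h₂ h₁
    have hlt := hi z (hW.segment_subset h₂ h₁ hz)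
    rw [map_smul, smul_eq_mul, abs_mul, abs_of_pos (inv_pos.mpr hpos), ← hzeq,
      inv_mul_eq_div, lt_div_iff₀ hpos] at hlt
    exact hlt.le.trans (Finset.single_le_sum (f := fun i => |ψ y₁ i - ψ y₂ i|)
      (fun j _ => abs_nonneg _) (Finset.mem_univ i))
  refine ⟨key, fun y₁ h₁ y₂ h₂ heq => ?_⟩
  have h := key y₁ h₁ y₂ h₂
  simp only [heq, sub_self, abs_zero, Finset.sum_const_zero] at h
  exact sub_eq_zero.mp (norm_le_zero_iff.mp (nonpos_of_mul_nonpos_right h ha))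
end

section
/- Let Ω be a topological space, J : Ω → ℝ a continuous function, X a nonempty compact topological space, and f : X → Ω a continuous map. Define c = inf{ sup_{θ∈X} J(g(θ)) : g : X → Ω continuous and homotopic to f }, and assume c ∈ ℝ (the infimum is finite). Then for every ε > 0 there exists a continuous map g : X → Ω homotopic to f with g(X) ⊆ J⁻¹((−∞, c + ε]) such that g, regarded as a map into the subspace J⁻¹((−∞, c + ε]), is NOT homotopic within J⁻¹((−∞, c + ε]) to any continuous map whose image is contained in J⁻¹((−∞, c − ε/2]). -/
/-- **Abstract minimax principle.** Let `J : Ω → ℝ` be continuous, `X` a nonempty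
compact space, `f : X → Ω` continuous, and let `c = inf { sup_X J∘g : g ≃ f }` be the
minimax value (assumed finite, i.e. the set of sup-values is bounded below). Then for
every `ε > 0` there is a continuous `g ≃ f` with image in the sublevel set
`{J ≤ c + ε}` which, regarded as a map into that sublevel set, is not homotopic within
it to any map with image in `{J ≤ c − ε/2}`. -/
theorem abstract_minimax
    {Ω X : Type*} [TopologicalSpace Ω] [TopologicalSpace X]
    [CompactSpace X] [Nonempty X]
    (J : Ω → ℝ) (hJ : Continuous J) (f : C(X, Ω))
    (S : Set ℝ)
    (hS : S = {s : ℝ | ∃ g : C(X, Ω), g.Homotopic f ∧ s = ⨆ θ : X, J (g θ)})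
    (hbdd : BddBelow S) :
    ∀ ε > (0 : ℝ),
      ∃ (g : C(X, Ω)) (hg : ∀ θ : X, g θ ∈ {ω : Ω | J ω ≤ sInf S + ε}),
        g.Homotopic f ∧
        ¬ ∃ g' : C(X, ({ω : Ω | J ω ≤ sInf S + ε} : Set Ω)),
            (∀ θ : X, J (g' θ : Ω) ≤ sInf S - ε / 2) ∧
            ContinuousMap.Homotopic
              ⟨Set.codRestrict g {ω : Ω | J ω ≤ sInf S + ε} hg,
                g.continuous.codRestrict hg⟩ g' := by
  subst hS
  intro ε hε
  have hne : {s : ℝ | ∃ g : C(X, Ω), g.Homotopic f ∧ s = ⨆ θ : X, J (g θ)}.Nonempty :=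
    ⟨_, f, ContinuousMap.Homotopic.refl f, rfl⟩
  obtain ⟨_, ⟨g, hgf, rfl⟩, hlt⟩ := exists_lt_of_csInf_lt hne (lt_add_of_pos_right _ hε)
  have hg_bdd : BddAbove (Set.range fun θ : X => J (g θ)) :=
    (isCompact_range (hJ.comp g.continuous)).bddAbove
  refine ⟨g, fun θ => (le_ciSup hg_bdd θ).trans hlt.le, hgf, ?_⟩
  rintro ⟨g', hg', hgg'⟩
  have hval := (ContinuousMap.Homotopic.refl
    (⟨Subtype.val, continuous_subtype_val⟩ : C(_, Ω))).comp hgg'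
  have hmem := csInf_le hbdd ⟨_, hval.symm.trans hgf, rfl⟩
  have hsup := hmem.trans (ciSup_le hg')
  linarith
end
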